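/- For n ≥ 1, the number of nonisomorphic unlabeled n-element semiorders of length at most three equals (3^{n−1} + 1)/2. -/

import Mathlib

namespace Paper

/-- Two elements are incomparable. -/
def Incomp {α : Type*} [PartialOrder α] (a b : α) : Prop := ¬ a ≤ b ∧ ¬ b ≤ a

/-- A semiorder: no induced `2+2` and no induced `3+1`. -/
def IsSemiorder (α : Type*) [PartialOrder α] : Prop :=
  (¬ ∃ x y z w : α, y < x ∧ w < z ∧ Incomp x z ∧ Incomp x w ∧ Incomp y z ∧ Incomp y w) ∧
  (¬ ∃ x y z w : α, z < y ∧ y < x ∧ Incomp x w ∧ Incomp y w ∧ Incomp z w)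

/-- There is a chain of `k` elements. -/
def HasChain (α : Type*) [Preorder α] (k : ℕ) : Prop := ∃ c : Fin k → α, StrictMono c

/-- The length of a longest chain (number of edges) is exactly `H`. -/
def HasLength (α : Type*) [Preorder α] (H : ℕ) : Prop :=
  HasChain α (H + 1) ∧ ¬ HasChain α (H + 2)

/-- There is a chain of `k` elements all strictly above `a`. -/
def HasChainAbove {α : Type*} [Preorder α] (a : α) (k : ℕ) : Prop :=
  ∃ c : Fin k → α, StrictMono c ∧ ∀ j, a < c j

/-- `a` is on the `i`-th level (`i ≥ 1`). -/
def OnLevel {α : Type*} [Preorder α] (a : α) (i : ℕ) : Prop :=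
  1 ≤ i ∧ HasChainAbove a (i - 1) ∧ ¬ HasChainAbove a i

/-- Number of isomorphism classes of partial orders on `Fin n` satisfying `pred`. -/
noncomputable def countPosets (n : ℕ) (pred : PartialOrder (Fin n) → Prop) : ℕ :=
  Nat.card (Quot (fun (P Q : {P : PartialOrder (Fin n) // pred P}) =>
    ∃ e : Fin n ≃ Fin n, ∀ a b : Fin n,
      (@LE.le _ P.1.toPreorder.toLE a b ↔ @LE.le _ Q.1.toPreorder.toLE (e a) (e b))))

/-- Semiorder of length exactly `H`. -/
def SemiLen (n H : ℕ) (P : PartialOrder (Fin n)) : Prop :=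
  @IsSemiorder (Fin n) P ∧ @HasLength (Fin n) P.toPreorder H

/-- Semiorder of length at most `h`. -/
def SemiLenLe (n h : ℕ) (P : PartialOrder (Fin n)) : Prop :=
  @IsSemiorder (Fin n) P ∧ ¬ @HasChain (Fin n) P.toPreorder (h + 2)

/-- `f_H^n`. -/
noncomputable def fEx (H n : ℕ) : ℕ := countPosets n (SemiLen n H)

/-- `f_{≤h}^n`. -/
noncomputable def fLe (h n : ℕ) : ℕ := countPosets n (SemiLenLe n h)

/-- Ordered (plane) trees. -/
inductive PTree where
  | node : List PTree → PTree

def PTree.size : PTree → ℕ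
  | .node cs => 1 + (cs.attach.map fun c => PTree.size c.1).sum
decreasing_by have := List.sizeOf_lt_of_mem c.2; simp only [PTree.node.sizeOf_spec] at *; omega

def PTree.height : PTree → ℕ
  | .node cs => (cs.attach.map fun c => PTree.height c.1 + 1).foldr max 0
decreasing_by have := List.sizeOf_lt_of_mem c.2; simp only [PTree.node.sizeOf_spec] at *; omega

def PTree.countDepth : PTree → ℕ → ℕ
  | .node _, 0 => 1
  | .node cs, d + 1 => (cs.attach.map fun c => PTree.countDepth c.1 d).sum
termination_by t _ => sizeOf t
decreasing_by have := List.sizeOf_lt_of_mem c.2; simp only [PTree.node.sizeOf_spec] at *; omega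

/-- Value of a path after the steps in `l` (`true` = up-step, `false` = down-step). -/
def pathVal (l : List Bool) : ℤ := (l.map fun b => if b then (1 : ℤ) else -1).sum

/-- `l` is a Dyck path. -/
def IsDyckPath (l : List Bool) : Prop :=
  pathVal l = 0 ∧ ∀ p, p <+: l → 0 ≤ pathVal p

/-- The height of the path `l` is exactly `H`. -/
def DyckHeightIs (l : List Bool) (H : ℕ) : Prop :=
  (∃ p, p <+: l ∧ pathVal p = H) ∧ ∀ p, p <+: l → pathVal p ≤ (H : ℤ)

/-- Number of peaks of a path. -/
def peaks (l : List Bool) : ℕ :=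
  ((List.range l.length).filter fun i => l.getD i false && !(l.getD (i + 1) true)).length

/-! ### Chains -/

theorem hasChain_succ_iff {α : Type*} [Preorder α] (k : ℕ) :
    HasChain α (k + 1) ↔ ∃ a : α, HasChainAbove a k := by
  constructor
  · rintro ⟨c, hc⟩
    exact ⟨c 0, fun i => c i.succ, fun i j hij => hc (Fin.succ_lt_succ_iff.2 hij),
      fun j => hc (Fin.succ_pos j)⟩
  · rintro ⟨a, c, hc, ha⟩
    refine ⟨Fin.cons a c, fun i j hij => ?_⟩
    induction j using Fin.cases with
    | zero => exact absurd hij (Fin.not_lt_zero i)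
    | succ j =>
      induction i using Fin.cases with
      | zero => simpa using ha j
      | succ i => simpa using hc (Fin.succ_lt_succ_iff.1 hij)

theorem hasChainAbove_succ_iff {α : Type*} [Preorder α] (a : α) (k : ℕ) :
    HasChainAbove a (k + 1) ↔ ∃ b, a < b ∧ HasChainAbove b k := by
  constructor
  · rintro ⟨c, hc, ha⟩
    exact ⟨c 0, ha 0, fun i => c i.succ, fun i j hij => hc (Fin.succ_lt_succ_iff.2 hij),
      fun j => hc (Fin.succ_pos j)⟩
  · rintro ⟨b, hab, c, hc, hb⟩
    refine ⟨Fin.cons b c, fun i j hij => ?_, fun j => ?_⟩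
    · induction j using Fin.cases with
      | zero => exact absurd hij (Fin.not_lt_zero i)
      | succ j =>
        induction i using Fin.cases with
        | zero => simpa using hb j
        | succ i => simpa using hc (Fin.succ_lt_succ_iff.1 hij)
    · induction j using Fin.cases with
      | zero => simpa using hab
      | succ j => simpa using hab.trans (hb j)

/-- The list `g` holds the down-set sizes of the elements `i, i + 1, …`; among these there are `k`
elements forming a chain, the least of which has more than `e` elements below it. -/
def ListChain (g : List ℕ) (i : ℕ) : ℕ → ℕ → Prop
  | 0, _ => True
  | k + 1, e => ∃ j, e < g.getD j 0 ∧ ListChain g i k (i + j)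

theorem ListChain.anti {g : List ℕ} {i k e e' : ℕ} (h : ListChain g i k e) (he : e' ≤ e) :
    ListChain g i k e' := by
  cases k with
  | zero => trivial
  | succ k =>
    obtain ⟨j, hj, h⟩ := h
    exact ⟨j, he.trans_lt hj, h⟩

theorem listChain_cons_of_le {v i : ℕ} {t : List ℕ} (hvi : v ≤ i) (k e : ℕ) (hve : v ≤ e) :
    ListChain (v :: t) i k e ↔ ListChain t (i + 1) k e := by
  induction k generalizing e with
  | zero => exact Iff.rfl
  | succ k ih =>
    constructor
    · rintro ⟨j, hj, h⟩
      cases j with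
      | zero => simp at hj; omega
      | succ j =>
        refine ⟨j, by simpa using hj, ?_⟩
        rw [ih _ (by omega)] at h
        rwa [add_assoc, add_comm 1 j]
    · rintro ⟨j, hj, h⟩
      refine ⟨j + 1, by simpa using hj, ?_⟩
      rw [ih _ (by omega)]
      rwa [add_assoc, add_comm 1 j] at h

theorem listChain_cons_of_lt {v i : ℕ} {t : List ℕ} (hvi : v ≤ i) (k e : ℕ) (hev : e < v) :
    ListChain (v :: t) i (k + 1) e ↔ ListChain t (i + 1) k i := by
  rw [← listChain_cons_of_le hvi k i hvi]
  constructor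
  · rintro ⟨j, -, h⟩
    exact h.anti (by omega)
  · exact fun h => ⟨0, by simpa using hev, by simpa using h⟩

/-- `σ` numbers the elements of `α` so that the strict down-set of the `j`-th element consists of
the first `g j` elements. -/
def Represents {α : Type*} [Preorder α] {n : ℕ} (g : List ℕ) (σ : Fin n ≃ α) : Prop :=
  g.length = n ∧ ∀ i j : Fin n, σ i < σ j ↔ (i : ℕ) < g.getD j 0

theorem Represents.hasChainAbove_iff {α : Type*} [Preorder α] {n : ℕ} {g : List ℕ}
    {σ : Fin n ≃ α} (h : Represents g σ) (k : ℕ) (a : Fin n) :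
    HasChainAbove (σ a) k ↔ ListChain g 0 k a := by
  induction k generalizing a with
  | zero => exact ⟨fun _ => trivial, fun _ => ⟨Fin.elim0, fun i => i.elim0, fun i => i.elim0⟩⟩
  | succ k ih =>
    rw [hasChainAbove_succ_iff]
    constructor
    · rintro ⟨b, hab, hb⟩
      obtain ⟨b, rfl⟩ := σ.surjective b
      exact ⟨b, (h.2 a b).1 hab, by simpa using (ih b).1 hb⟩
    · rintro ⟨j, hj, hc⟩
      have hjn : j < n := by
        by_contra hjn
        rw [List.getD_eq_default _ _ (by have := h.1; omega)] at hj
        omega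
      exact ⟨σ ⟨j, hjn⟩, (h.2 a ⟨j, hjn⟩).2 hj, (ih ⟨j, hjn⟩).2 (by simpa using hc)⟩

theorem Represents.hasChain_iff {α : Type*} [Preorder α] {n : ℕ} (hn : 1 ≤ n) {g : List ℕ}
    {σ : Fin n ≃ α} (h : Represents g σ) (k : ℕ) :
    HasChain α (k + 1) ↔ ListChain g 0 k 0 := by
  rw [hasChain_succ_iff]
  constructor
  · rintro ⟨a, ha⟩
    obtain ⟨a, rfl⟩ := σ.surjective a
    exact ((h.hasChainAbove_iff k a).1 ha).anti (Nat.zero_le _)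
  · exact fun hc => ⟨σ ⟨0, hn⟩, (h.hasChainAbove_iff k ⟨0, hn⟩).2 hc⟩

/-! ### Numbering a semiorder by down-sets -/

theorem IsSemiorder.lt_or_lt {α : Type*} [PartialOrder α] (h : IsSemiorder α) {a b x y : α}
    (hax : a < x) (hby : b < y) : a < y ∨ b < x := by
  by_contra! hc
  obtain ⟨hay, hbx⟩ := hc
  exact h.1 ⟨x, a, y, b, hax, hby,
    ⟨fun h => hay (hax.trans_le h), fun h => hbx (hby.trans_le h)⟩,
    ⟨fun h => hay ((hax.trans_le h).trans hby), fun h => hbx (h.lt_of_ne fun e =>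
      hay (by rw [e] at hby; exact hax.trans hby))⟩,
    ⟨fun h => hay (h.lt_of_ne fun e => hbx (by rw [← e] at hby; exact hby.trans hax)),
      fun h => hbx ((hby.trans_le h).trans hax)⟩,
    ⟨fun h => hay (h.trans_lt hby), fun h => hbx (h.trans_lt hax)⟩⟩

section Sorting

variable {α : Type*} [PartialOrder α] [Fintype α]

open Classical in
/-- The number of elements below `x`. -/
noncomputable def downCard (x : α) : ℕ := (Finset.univ.filter (· < x)).card

open Classical in
/-- The number of elements above `x`. -/
noncomputable def upCard (x : α) : ℕ := (Finset.univ.filter (x < ·)).card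

theorem exists_lt_of_downCard_le {x y a : α} (h : downCard x ≤ downCard y) (hax : a < x)
    (hay : ¬ a < y) : ∃ b, b < y ∧ ¬ b < x := by
  classical
  by_contra! hb
  refine absurd h (not_le.2 (Finset.card_lt_card (Finset.ssubset_iff_of_subset ?_ |>.2 ⟨a, ?_⟩)))
  · intro b
    simpa using hb b
  · simp [hax, hay]

theorem exists_gt_of_upCard_le {x y a : α} (h : upCard x ≤ upCard y) (hax : x < a)
    (hay : ¬ y < a) : ∃ b, y < b ∧ ¬ x < b := by
  classical
  by_contra! hb
  refine absurd h (not_le.2 (Finset.card_lt_card (Finset.ssubset_iff_of_subset ?_ |>.2 ⟨a, ?_⟩)))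
  · intro b
    simpa using hb b
  · simp [hax, hay]

theorem exists_lt_of_downCard_lt {x y : α} (h : downCard x < downCard y) :
    ∃ b, b < y ∧ ¬ b < x := by
  classical
  by_contra! hb
  refine absurd h (not_lt.2 (Finset.card_le_card fun b => ?_))
  simpa using hb b

theorem exists_gt_of_upCard_lt {x y : α} (h : upCard x < upCard y) :
    ∃ b, y < b ∧ ¬ x < b := by
  classical
  by_contra! hb
  refine absurd h (not_lt.2 (Finset.card_le_card fun b => ?_))
  simpa using hb b

theorem IsSemiorder.lt_of_downCard_le (h : IsSemiorder α) {x y a : α}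
    (hxy : downCard x ≤ downCard y) (hax : a < x) : a < y := by
  by_contra hay
  obtain ⟨b, hby, hbx⟩ := exists_lt_of_downCard_le hxy hax hay
  exact (h.lt_or_lt hax hby).elim hay hbx

theorem IsSemiorder.lt_of_upCard_le (h : IsSemiorder α) {x y a : α}
    (hxy : upCard x ≤ upCard y) (hax : x < a) : y < a := by
  by_contra hay
  obtain ⟨b, hby, hbx⟩ := exists_gt_of_upCard_le hxy hax hay
  exact (h.lt_or_lt hax hby).elim hbx hay

theorem IsSemiorder.upCard_le (h : IsSemiorder α) {x y : α}
    (hxy : downCard x < downCard y) : upCard y ≤ upCard x := by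
  by_contra! hu
  obtain ⟨a, hay, hax⟩ := exists_lt_of_downCard_lt hxy
  obtain ⟨b, hyb, hxb⟩ := exists_gt_of_upCard_lt hu
  refine h.2 ⟨b, y, a, x, hay, hyb, ⟨fun h => ?_, fun h => ?_⟩, ⟨fun h => ?_, fun h => ?_⟩,
    ⟨fun h => ?_, fun h => ?_⟩⟩
  · exact hax ((hay.trans hyb).trans_le h)
  · exact hxb (h.lt_of_ne fun e => hax (by rw [e]; exact hay.trans hyb))
  · exact hax (hay.trans_le h)
  · exact hxb (h.trans_lt hyb)
  · exact hax (h.lt_of_ne fun e => hxb (by rw [← e]; exact hay.trans hyb))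
  · exact hxb ((h.trans_lt hay).trans hyb)

theorem downCard_eq_card_filter {n : ℕ} (σ : Fin n ≃ α) (x : α)
    [DecidablePred fun i => σ i < x] : downCard x = (Finset.univ.filter fun i => σ i < x).card := by
  unfold downCard
  rw [← Finset.card_map σ.toEmbedding]
  congr 1
  ext a
  simp

variable (α) in
/-- The multiset of the down-set sizes of the elements of `α`. -/
noncomputable def downMultiset : Multiset ℕ := Finset.univ.val.map fun x : α => downCard x

theorem downMultiset_congr {β : Type*} [PartialOrder β] [Fintype β] (e : α ≃ β)
    (he : ∀ a b, a ≤ b ↔ e a ≤ e b) : downMultiset α = downMultiset β := by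
  have hd : ∀ x : α, downCard x = downCard (e x) := by
    intro x
    unfold downCard
    rw [← Finset.card_map e.toEmbedding]
    congr 1
    ext b
    simp [lt_iff_le_not_ge, he]
  unfold downMultiset
  simp only [hd]
  rw [← Finset.map_univ_equiv e, Finset.map_val, Multiset.map_map]
  rfl

theorem Represents.downMultiset_eq {n : ℕ} {g : List ℕ} {σ : Fin n ≃ α} (h : Represents g σ)
    (hg : ∀ j, g.getD j 0 ≤ j) : downMultiset α = g := by
  classical
  have hd : ∀ j : Fin n, downCard (σ j) = g.getD j 0 := by
    intro j
    simp only [downCard_eq_card_filter σ, h.2]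
    rw [Fin.card_filter_val_lt]
    have := hg j
    omega
  unfold downMultiset
  rw [← Finset.map_univ_equiv σ, Finset.map_val, Multiset.map_map]
  simp only [Function.comp_def, Equiv.coe_toEmbedding, hd, Fin.univ_val_map]
  obtain ⟨rfl, -⟩ := h
  congr 1
  refine List.ext_getElem (by simp) fun i h1 h2 => ?_
  simp [List.getD_eq_getElem?_getD]

end Sorting

theorem mem_iff_lt_card_of_isLowerSet {n : ℕ} (s : Finset (Fin n))
    (hs : IsLowerSet (s : Set (Fin n))) (i : Fin n) : i ∈ s ↔ (i : ℕ) < s.card := by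
  constructor
  · intro hi
    have : Finset.Iic i ⊆ s := fun j hj => hs (Finset.mem_Iic.1 hj) hi
    have := Finset.card_le_card this
    rw [Fin.card_Iic] at this
    omega
  · intro hi
    by_contra his
    have : s ⊆ Finset.Iio i := fun j hj =>
      Finset.mem_Iio.2 (lt_of_not_ge fun hij => his (hs hij hj))
    have := Finset.card_le_card this
    rw [Fin.card_Iio] at this
    omega

theorem IsSemiorder.exists_represents {α : Type*} [PartialOrder α] {n : ℕ} (e : Fin n ≃ α)
    (h : IsSemiorder α) : ∃ (g : List ℕ) (σ : Fin n ≃ α), Represents g σ ∧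
      g.Pairwise (· ≤ ·) ∧ ∀ j, g.getD j 0 ≤ j := by
  classical
  let _ : Fintype α := Fintype.ofEquiv _ e
  let key : Fin n → ℤ := fun i => (downCard (e i) : ℤ) - upCard (e i)
  let σ : Fin n ≃ α := (Tuple.sort key).trans e
  have hkey : Monotone fun i => (downCard (σ i) : ℤ) - upCard (σ i) := Tuple.monotone_sort key
  have hd : Monotone fun i => downCard (σ i) := by
    intro i j hij
    by_contra! hlt
    have h1 := h.upCard_le hlt
    have h2 := hkey hij
    simp only at h1 h2 hlt
    omega
  have hu : Antitone fun i => upCard (σ i) := by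
    intro i j hij
    by_contra! hlt
    have h2 := hkey hij
    have h3 : downCard (σ i) < downCard (σ j) := by
      simp only at h2 hlt
      omega
    exact absurd (h.upCard_le h3) (not_le.2 hlt)
  have hlt : ∀ i j : Fin n, σ i < σ j ↔ (i : ℕ) < downCard (σ j) := by
    intro i j
    rw [downCard_eq_card_filter σ, ← mem_iff_lt_card_of_isLowerSet]
    · simp
    · intro a b hba ha
      simp only [Finset.coe_filter, Finset.mem_univ, true_and, Set.mem_ofPred_eq] at ha ⊢
      exact h.lt_of_upCard_le (hu hba) ha
  have hget : ∀ j : Fin n, (List.ofFn fun i => downCard (σ i)).getD j 0 = downCard (σ j) := by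
    intro j
    simp [List.getD_eq_getElem?_getD]
  refine ⟨List.ofFn fun i => downCard (σ i), σ, ⟨by simp, fun i j => by rw [hget, hlt]⟩, ?_, ?_⟩
  · rw [List.pairwise_ofFn]
    exact fun i j hij => hd hij.le
  · intro j
    by_cases hj : j < n
    · have := hget ⟨j, hj⟩
      simp only at this
      rw [this]
      exact not_lt.1 fun hl => lt_irrefl _ ((hlt ⟨j, hj⟩ ⟨j, hj⟩).2 hl)
    · rw [List.getD_eq_default _ _ (by simpa using hj)]
      exact Nat.zero_le _

/-! ### The semiorder with given down-set sizes -/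

/-- The order on `Fin n` in which the strict down-set of `j` consists of the first `g j`
elements. -/
@[reducible]
def orderOfList (n : ℕ) (g : List ℕ) (hg : ∀ j, g.getD j 0 ≤ j) : PartialOrder (Fin n) where
  le i j := i = j ∨ (i : ℕ) < g.getD j 0
  lt i j := (i : ℕ) < g.getD j 0
  le_refl i := Or.inl rfl
  le_trans i j k := by
    rintro (rfl | hij) (rfl | hjk)
    · exact Or.inl rfl
    · exact Or.inr hjk
    · exact Or.inr hij
    · have := hg j
      exact Or.inr (by omega)
  le_antisymm i j := by
    rintro (rfl | hij) (h | hji)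
    · rfl
    · rfl
    · exact h.symm
    · have := hg j
      have := hg i
      omega
  lt_iff_le_not_ge i j := by
    have h1 := hg i
    have h2 := hg j
    constructor
    · intro h
      refine ⟨Or.inr h, ?_⟩
      rintro (rfl | h') <;> omega
    · rintro ⟨rfl | h, h'⟩
      · simp at h'
      · exact h

theorem orderOfList_le_iff {n : ℕ} {g : List ℕ} (hg : ∀ j, g.getD j 0 ≤ j) (i j : Fin n) :
    (orderOfList n g hg).le i j ↔ i = j ∨ (i : ℕ) < g.getD j 0 := Iff.rfl

theorem orderOfList_lt_iff {n : ℕ} {g : List ℕ} (hg : ∀ j, g.getD j 0 ≤ j) (i j : Fin n) :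
    (orderOfList n g hg).lt i j ↔ (i : ℕ) < g.getD j 0 := Iff.rfl

theorem represents_orderOfList {n : ℕ} {g : List ℕ} (hg : ∀ j, g.getD j 0 ≤ j)
    (hlen : g.length = n) :
    @Represents (Fin n) (orderOfList n g hg).toPreorder n g (Equiv.refl _) :=
  ⟨hlen, fun i j => orderOfList_lt_iff hg i j⟩

theorem getD_mono_of_pairwise {g : List ℕ} (hs : g.Pairwise (· ≤ ·)) {i j : ℕ} (hij : i ≤ j)
    (hj : j < g.length) : g.getD i 0 ≤ g.getD j 0 := by
  rw [List.getD_eq_getElem _ _ hj, List.getD_eq_getElem _ _ (hij.trans_lt hj)]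
  rcases hij.eq_or_lt with rfl | h
  · rfl
  · exact List.pairwise_iff_getElem.1 hs i j _ _ h

theorem isSemiorder_orderOfList {n : ℕ} {g : List ℕ} (hg : ∀ j, g.getD j 0 ≤ j)
    (hlen : g.length = n) (hs : g.Pairwise (· ≤ ·)) :
    @IsSemiorder (Fin n) (orderOfList n g hg) := by
  have hI : ∀ a b, @Incomp (Fin n) (orderOfList n g hg) a b →
      g.getD b 0 ≤ (a : ℕ) ∧ g.getD a 0 ≤ (b : ℕ) := by
    rintro a b ⟨h1, h2⟩
    exact ⟨not_lt.1 fun h => h1 (Or.inr h), not_lt.1 fun h => h2 (Or.inr h)⟩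
  constructor
  · rintro ⟨x, y, z, w, hyx, hwz, -, hxw, hyz, -⟩
    rw [orderOfList_lt_iff] at hyx hwz
    have := hI _ _ hxw
    have := hI _ _ hyz
    omega
  · rintro ⟨x, y, z, w, hzy, hyx, hxw, -, hzw⟩
    rw [orderOfList_lt_iff] at hzy hyx
    have h1 := hI _ _ hxw
    have h2 := hI _ _ hzw
    have := getD_mono_of_pairwise hs (i := y) (j := w) (by omega) (by omega)
    omega

/-! ### Counting the sequences of down-set sizes -/

/-- Weakly increasing sequences, bounded below by `l`, of possible down-set sizes for the elements
`i, i + 1, …`, such that no `h + 1` of them form a chain whose elements all have more than `e`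
elements below them. -/
def Admissible (h l e i : ℕ) (g : List ℕ) : Prop :=
  (l :: g).Pairwise (· ≤ ·) ∧ (∀ j, g.getD j 0 ≤ i + j) ∧ ¬ ListChain g i (h + 1) e

theorem pairwise_le_cons_cons {l v : ℕ} {t : List ℕ} :
    (l :: v :: t).Pairwise (· ≤ ·) ↔ l ≤ v ∧ (v :: t).Pairwise (· ≤ ·) := by
  simp only [List.pairwise_cons, List.mem_cons, forall_eq_or_imp]
  constructor
  · rintro ⟨⟨h1, -⟩, h2⟩
    exact ⟨h1, h2⟩
  · rintro ⟨h1, h2, h3⟩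
    exact ⟨⟨h1, fun a ha => h1.trans (h2 a ha)⟩, h2, h3⟩

theorem getD_cons_le_iff {v i : ℕ} {t : List ℕ} :
    (∀ j, (v :: t).getD j 0 ≤ i + j) ↔ v ≤ i ∧ ∀ j, t.getD j 0 ≤ i + 1 + j := by
  constructor
  · intro h
    refine ⟨by simpa using h 0, fun j => ?_⟩
    have := h (j + 1)
    rw [List.getD_cons_succ] at this
    omega
  · rintro ⟨h0, h⟩ j
    cases j with
    | zero => simpa using h0
    | succ j =>
      rw [List.getD_cons_succ]
      have := h j
      omega

theorem admissible_nil (h l e i : ℕ) : Admissible h l e i [] := by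
  refine ⟨by simp, by simp, ?_⟩
  rintro ⟨j, hj, -⟩
  simp at hj

theorem admissible_cons_of_le {h l e i v : ℕ} {t : List ℕ} (hei : e ≤ i) (hve : v ≤ e) :
    Admissible h l e i (v :: t) ↔ l ≤ v ∧ Admissible h v e (i + 1) t := by
  unfold Admissible
  rw [pairwise_le_cons_cons, getD_cons_le_iff, listChain_cons_of_le (hve.trans hei) _ _ hve]
  have := hve.trans hei
  tauto

theorem admissible_cons_of_lt {h l e i v : ℕ} {t : List ℕ} (hev : e < v) :
    Admissible (h + 1) l e i (v :: t) ↔ l ≤ v ∧ v ≤ i ∧ Admissible h v i (i + 1) t := by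
  unfold Admissible
  rw [pairwise_le_cons_cons, getD_cons_le_iff]
  constructor
  · rintro ⟨⟨h1, h2⟩, ⟨h3, h4⟩, h5⟩
    rw [listChain_cons_of_lt h3 _ _ hev] at h5
    exact ⟨h1, h3, h2, h4, h5⟩
  · rintro ⟨h1, h3, h2, h4, h5⟩
    rw [listChain_cons_of_lt h3 _ _ hev]
    exact ⟨⟨h1, h2⟩, ⟨h3, h4⟩, h5⟩

theorem not_admissible_zero_cons {l e i v : ℕ} {t : List ℕ} (hev : e < v) :
    ¬ Admissible 0 l e i (v :: t) :=
  fun h => h.2.2 ⟨0, by simpa using hev, trivial⟩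

/-- The admissible sequences of a given length. -/
def admissibleLists : (m h l e i : ℕ) → Finset (List ℕ)
  | 0, _, _, _, _ => {[]}
  | m + 1, 0, l, e, i =>
    (Finset.Icc l e).biUnion fun v => (admissibleLists m 0 v e (i + 1)).image (List.cons v)
  | m + 1, h + 1, l, e, i =>
    ((Finset.Icc l e).biUnion fun v =>
      (admissibleLists m (h + 1) v e (i + 1)).image (List.cons v)) ∪
    (Finset.Ioc e i).biUnion fun v => (admissibleLists m h v i (i + 1)).image (List.cons v)

theorem mem_admissibleLists {m h l e i : ℕ} (hle : l ≤ e) (hei : e ≤ i) (g : List ℕ) :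
    g ∈ admissibleLists m h l e i ↔ g.length = m ∧ Admissible h l e i g := by
  induction m generalizing h l e i g with
  | zero =>
    simp only [admissibleLists, Finset.mem_singleton, List.length_eq_zero_iff]
    exact ⟨fun hg => ⟨hg, hg ▸ admissible_nil _ _ _ _⟩, fun hg => hg.1⟩
  | succ m ih =>
    have h_le : (∃ v, (l ≤ v ∧ v ≤ e) ∧ ∃ t, t ∈ admissibleLists m h v e (i + 1) ∧ v :: t = g) ↔
        ∃ v t, v :: t = g ∧ v ≤ e ∧ g.length = m + 1 ∧ Admissible h l e i g := by
      constructor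
      · rintro ⟨v, ⟨hlv, hve⟩, t, ht, rfl⟩
        rw [ih hve (by omega)] at ht
        exact ⟨v, t, rfl, hve, by simp [ht.1], (admissible_cons_of_le hei hve).2 ⟨hlv, ht.2⟩⟩
      · rintro ⟨v, t, rfl, hve, hlen, ha⟩
        rw [admissible_cons_of_le hei hve] at ha
        exact ⟨v, ⟨ha.1, hve⟩, t, (ih hve (by omega) t).2 ⟨by simpa using hlen, ha.2⟩, rfl⟩
    cases h with
    | zero =>
      simp only [admissibleLists, Finset.mem_biUnion, Finset.mem_Icc, Finset.mem_image]
      rw [h_le]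
      constructor
      · rintro ⟨v, t, -, -, hg⟩
        exact hg
      · intro hg
        cases g with
        | nil => simp at hg
        | cons v t =>
          exact ⟨v, t, rfl, not_lt.1 fun hev => not_admissible_zero_cons hev hg.2, hg⟩
    | succ h =>
      simp only [admissibleLists, Finset.mem_union, Finset.mem_biUnion, Finset.mem_Icc,
        Finset.mem_image, Finset.mem_Ioc]
      rw [h_le]
      constructor
      · rintro (⟨v, t, -, -, hg⟩ | ⟨v, ⟨hev, hvi⟩, t, ht, rfl⟩)
        · exact hg
        · rw [ih hvi (by omega)] at ht
          exact ⟨by simp [ht.1], (admissible_cons_of_lt hev).2 ⟨by omega, hvi, ht.2⟩⟩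
      · intro hg
        cases g with
        | nil => simp at hg
        | cons v t =>
          rcases le_or_gt v e with hve | hev
          · exact Or.inl ⟨v, t, rfl, hve, hg⟩
          · obtain ⟨hlen, ha⟩ := hg
            rw [admissible_cons_of_lt hev] at ha
            exact Or.inr ⟨v, ⟨hev, ha.2.1⟩, t,
              (ih ha.2.1 (by omega) t).2 ⟨by simpa using hlen, ha.2.2⟩, rfl⟩

theorem card_biUnion_image_cons (s : Finset ℕ) (F : ℕ → Finset (List ℕ)) :
    (s.biUnion fun v => (F v).image (List.cons v)).card = ∑ v ∈ s, (F v).card := by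
  rw [Finset.card_biUnion]
  · exact Finset.sum_congr rfl fun v _ => Finset.card_image_of_injective _ List.cons_injective
  · intro v _ w _ hvw
    rw [Function.onFun, Finset.disjoint_left]
    simp only [Finset.mem_image, not_exists, not_and]
    rintro _ ⟨t, -, rfl⟩ u - h
    simp only [List.cons.injEq] at h
    exact hvw h.1.symm

theorem card_admissibleLists_zero_succ (m l e i : ℕ) :
    (admissibleLists (m + 1) 0 l e i).card =
      ∑ v ∈ Finset.Icc l e, (admissibleLists m 0 v e (i + 1)).card :=
  card_biUnion_image_cons _ _

theorem card_admissibleLists_succ_succ (m h l e i : ℕ) :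
    (admissibleLists (m + 1) (h + 1) l e i).card =
      ∑ v ∈ Finset.Icc l e, (admissibleLists m (h + 1) v e (i + 1)).card +
      ∑ v ∈ Finset.Ioc e i, (admissibleLists m h v i (i + 1)).card := by
  rw [admissibleLists, Finset.card_union_of_disjoint, card_biUnion_image_cons,
    card_biUnion_image_cons]
  rw [Finset.disjoint_left]
  simp only [Finset.mem_biUnion, Finset.mem_Icc, Finset.mem_Ioc, Finset.mem_image, not_exists,
    not_and]
  rintro _ ⟨v, hv, t, -, rfl⟩ w hw u - h
  simp only [List.cons.injEq] at h
  omega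

/-! ### Generating functions -/

open PowerSeries in
/-- The generating function of plane trees of height at most `h`, by number of edges. -/
noncomputable def treeSeries : ℕ → PowerSeries ℚ
  | 0 => 1
  | h + 1 => (1 - X * treeSeries h)⁻¹

open PowerSeries in
theorem treeSeries_succ_mul (h : ℕ) : treeSeries (h + 1) * (1 - X * treeSeries h) = 1 := by
  rw [treeSeries]
  exact PowerSeries.inv_mul_cancel _ (by simp)

open PowerSeries in
theorem X_mul_treeSeries_mul (h : ℕ) :
    X * (treeSeries h * treeSeries (h + 1)) = treeSeries (h + 1) - 1 := by
  linear_combination -treeSeries_succ_mul h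

theorem sum_Icc_pow_sub {l e : ℕ} (hle : l ≤ e) (x : PowerSeries ℚ) :
    ∑ v ∈ Finset.Icc l e, x ^ (e - v) = ∑ p ∈ Finset.range (e - l + 1), x ^ p := by
  refine Finset.sum_nbij' (fun v => e - v) (fun p => e - p) ?_ ?_ ?_ ?_ ?_ <;>
    simp only [Finset.mem_Icc, Finset.mem_range] <;> intros <;> first | trivial | omega

theorem sum_Ioc_pow_sub {e i : ℕ} (hei : e ≤ i) (x : PowerSeries ℚ) :
    ∑ v ∈ Finset.Ioc e i, x ^ (i - v) = ∑ p ∈ Finset.range (i - e), x ^ p := by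
  refine Finset.sum_nbij' (fun v => i - v) (fun p => i - p) ?_ ?_ ?_ ?_ ?_ <;>
    simp only [Finset.mem_Ioc, Finset.mem_range] <;> intros <;> first | trivial | omega

open PowerSeries in
theorem X_mul_sum_Icc {l e i : ℕ} (h : ℕ) (hle : l ≤ e) (hei : e ≤ i) :
    X * ∑ v ∈ Finset.Icc l e, treeSeries h ^ (i + 1 - e) * treeSeries (h + 1) ^ (e - v + 1) =
      treeSeries h ^ (i - e) * treeSeries (h + 1) ^ (e - l + 1) - treeSeries h ^ (i - e) := by
  have hsum : ∑ v ∈ Finset.Icc l e,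
      treeSeries h ^ (i + 1 - e) * treeSeries (h + 1) ^ (e - v + 1) =
      treeSeries h ^ (i - e) * (treeSeries h * treeSeries (h + 1)) *
        ∑ p ∈ Finset.range (e - l + 1), treeSeries (h + 1) ^ p := by
    rw [← sum_Icc_pow_sub hle, Finset.mul_sum]
    refine Finset.sum_congr rfl fun v _ => ?_
    rw [Nat.sub_add_comm hei]
    ring
  rw [hsum]
  linear_combination treeSeries h ^ (i - e) *
    ((∑ p ∈ Finset.range (e - l + 1), treeSeries (h + 1) ^ p) * X_mul_treeSeries_mul h +
      geom_sum_mul (treeSeries (h + 1)) (e - l + 1))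

open PowerSeries in
theorem X_mul_sum_Ioc {e i : ℕ} (h : ℕ) (hei : e ≤ i) :
    X * ∑ v ∈ Finset.Ioc e i, treeSeries h ^ (i + 1 - i) * treeSeries (h + 1) ^ (i - v + 1) =
      treeSeries (h + 1) ^ (i - e) - 1 := by
  have hsum : ∑ v ∈ Finset.Ioc e i,
      treeSeries h ^ (i + 1 - i) * treeSeries (h + 1) ^ (i - v + 1) =
      (treeSeries h * treeSeries (h + 1)) *
        ∑ p ∈ Finset.range (i - e), treeSeries (h + 1) ^ p := by
    rw [← sum_Ioc_pow_sub hei, Finset.mul_sum]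
    refine Finset.sum_congr rfl fun v _ => ?_
    rw [Nat.add_sub_cancel_left]
    ring
  rw [hsum]
  linear_combination
    (∑ p ∈ Finset.range (i - e), treeSeries (h + 1) ^ p) * X_mul_treeSeries_mul h +
      geom_sum_mul (treeSeries (h + 1)) (i - e)

theorem constantCoeff_treeSeries (h : ℕ) : PowerSeries.constantCoeff (treeSeries h) = 1 := by
  cases h with
  | zero => simp [treeSeries]
  | succ h =>
    have := congrArg PowerSeries.constantCoeff (treeSeries_succ_mul h)
    simpa using this

open PowerSeries in
theorem card_admissibleLists {m h l e i : ℕ} (hle : l ≤ e) (hei : e ≤ i) :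
    ((admissibleLists m h l e i).card : ℚ) =
      coeff m (treeSeries h ^ (i - e) * treeSeries (h + 1) ^ (e - l + 1)) := by
  induction m generalizing h l e i with
  | zero => simp [admissibleLists, constantCoeff_treeSeries]
  | succ m ih =>
    have hI : ∀ h, ∑ v ∈ Finset.Icc l e, ((admissibleLists m h v e (i + 1)).card : ℚ) =
        coeff (m + 1) (treeSeries h ^ (i - e) * treeSeries (h + 1) ^ (e - l + 1) -
          treeSeries h ^ (i - e)) := by
      intro h
      rw [← X_mul_sum_Icc h hle hei, coeff_succ_X_mul, map_sum]
      exact Finset.sum_congr rfl fun v hv => ih (Finset.mem_Icc.1 hv).2 (by omega)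
    cases h with
    | zero =>
      rw [card_admissibleLists_zero_succ, Nat.cast_sum, hI]
      simp [treeSeries, coeff_one]
    | succ h =>
      have hJ : ∑ v ∈ Finset.Ioc e i, ((admissibleLists m h v i (i + 1)).card : ℚ) =
          coeff (m + 1) (treeSeries (h + 1) ^ (i - e) - 1) := by
        rw [← X_mul_sum_Ioc h hei, coeff_succ_X_mul, map_sum]
        exact Finset.sum_congr rfl fun v hv => ih (Finset.mem_Ioc.1 hv).2 (by omega)
      rw [card_admissibleLists_succ_succ, Nat.cast_add, Nat.cast_sum, Nat.cast_sum, hI, hJ,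
        ← map_add]
      have : coeff (m + 1) (1 : PowerSeries ℚ) = 0 := by simp [coeff_one]
      simp only [map_sub, map_add, this]
      ring

open PowerSeries in
theorem two_mul_treeSeries_four :
    2 * treeSeries 4 = 2 + X * (mk (fun n => (3 : ℚ) ^ n) + mk 1) := by
  have hA : mk (fun n => (3 : ℚ) ^ n) * (1 - 3 * X) = 1 := by
    ext n
    cases n with
    | zero => simp
    | succ n =>
      have : mk (fun n => (3 : ℚ) ^ n) * (1 - 3 * X) =
          mk (fun n => (3 : ℚ) ^ n) - C 3 * (mk (fun n => (3 : ℚ) ^ n) * X) := by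
        rw [show (C 3 : PowerSeries ℚ) = 3 from map_ofNat C 3]
        ring
      rw [this, map_sub, coeff_C_mul, coeff_succ_mul_X]
      simp [coeff_one, pow_succ, mul_comm]
  have hB : (mk 1 : PowerSeries ℚ) * (1 - X) = 1 := mk_one_mul_one_sub_eq_one ℚ
  have h0 : treeSeries 0 = 1 := rfl
  have h1 := treeSeries_succ_mul 0
  have h2 := treeSeries_succ_mul 1
  have h3 := treeSeries_succ_mul 2
  have h4 := treeSeries_succ_mul 3
  norm_num at h1 h2 h3 h4
  rw [h0] at h1
  have k2 : treeSeries 2 * (1 - 2 * X) = 1 - X := by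
    linear_combination (1 - X) * h2 + X * treeSeries 2 * h1
  have k3 : treeSeries 3 * (1 - 3 * X + X ^ 2) = 1 - 2 * X := by
    linear_combination (1 - 2 * X) * h3 + X * treeSeries 3 * k2
  have k4 : treeSeries 4 * ((1 - X) * (1 - 3 * X)) = 1 - 3 * X + X ^ 2 := by
    linear_combination (1 - 3 * X + X ^ 2) * h4 + X * treeSeries 4 * k3
  generalize mk (fun n => (3 : ℚ) ^ n) = A at *
  generalize (mk 1 : PowerSeries ℚ) = B at *
  linear_combination 2 * A * B * k4 + 2 * (1 - treeSeries 4) * (B * (1 - X) * hA + hB) +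
    X * A * hB + X * B * hA

theorem card_admissibleLists_three {n : ℕ} (hn : 1 ≤ n) :
    (admissibleLists n 3 0 0 0).card = (3 ^ (n - 1) + 1) / 2 := by
  obtain ⟨n, rfl⟩ := Nat.exists_eq_add_of_le' hn
  have h := card_admissibleLists (m := n + 1) (h := 3) le_rfl (le_refl 0)
  have h4 := congrArg (PowerSeries.coeff (n + 1)) two_mul_treeSeries_four
  rw [two_mul, map_add, map_add, PowerSeries.coeff_succ_X_mul,
    show (2 : PowerSeries ℚ) = PowerSeries.C 2 from (map_ofNat PowerSeries.C 2).symm] at h4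
  simp at h h4
  have : ((2 * (admissibleLists (n + 1) 3 0 0 0).card : ℕ) : ℚ) = ((3 ^ n + 1 : ℕ) : ℚ) := by
    push_cast
    rw [h, two_mul, h4]
  have := Nat.cast_injective this
  rw [Nat.add_sub_cancel]
  omega

/-! ### Counting isomorphism classes -/

theorem admissible_zero_iff {h : ℕ} {g : List ℕ} : Admissible h 0 0 0 g ↔
    g.Pairwise (· ≤ ·) ∧ (∀ j, g.getD j 0 ≤ j) ∧ ¬ ListChain g 0 (h + 1) 0 := by
  simp [Admissible]

theorem fLe_eq_card {n : ℕ} (hn : 1 ≤ n) (h : ℕ) : fLe h n = (admissibleLists n h 0 0 0).card := by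
  classical
  have hmem : ∀ g : admissibleLists n h 0 0 0, g.1.length = n ∧ g.1.Pairwise (· ≤ ·) ∧
      (∀ j, g.1.getD j 0 ≤ j) ∧ ¬ ListChain g.1 0 (h + 1) 0 := fun g => by
    have := g.2
    rwa [mem_admissibleLists le_rfl le_rfl, admissible_zero_iff] at this
  have hsemi : ∀ g : admissibleLists n h 0 0 0, SemiLenLe n h (orderOfList n g.1 (hmem g).2.2.1) :=
    fun g => ⟨isSemiorder_orderOfList _ (hmem g).1 (hmem g).2.1, fun hc => (hmem g).2.2.2
      ((@Represents.hasChain_iff _ (orderOfList n g.1 (hmem g).2.2.1).toPreorder _ hn _ _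
        (represents_orderOfList _ (hmem g).1) (h + 1)).1 hc)⟩
  have hdown : ∀ g : admissibleLists n h 0 0 0,
      @downMultiset (Fin n) (orderOfList n g.1 (hmem g).2.2.1) _ = (g.1 : Multiset ℕ) :=
    fun g => @Represents.downMultiset_eq _ (orderOfList n g.1 (hmem g).2.2.1) _ _ _ _
      (represents_orderOfList _ (hmem g).1) (hmem g).2.2.1
  unfold fLe countPosets
  rw [← Fintype.card_coe, ← Nat.card_eq_fintype_card]
  symm
  refine Nat.card_congr (Equiv.ofBijective (fun g => Quot.mk _ ⟨_, hsemi g⟩) ⟨?_, ?_⟩)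
  · intro g g' hgg
    have hperm : (g.1 : Multiset ℕ) = g'.1 := by
      rw [← hdown g, ← hdown g']
      refine congrArg (Quot.lift (fun P : {P : PartialOrder (Fin n) // SemiLenLe n h P} =>
        @downMultiset (Fin n) P.1 _) ?_) hgg
      rintro ⟨P, hP⟩ ⟨Q, hQ⟩ ⟨e, he⟩
      exact @downMultiset_congr _ P _ _ Q _ e he
    exact Subtype.ext ((Multiset.coe_eq_coe.1 hperm).eq_of_pairwise'
      (hmem g).2.1 (hmem g').2.1)
  · rintro ⟨P, hP⟩
    obtain ⟨g, σ, hr, hs, hg⟩ := @IsSemiorder.exists_represents _ P n (Equiv.refl _) hP.1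
    refine ⟨⟨g, (mem_admissibleLists le_rfl le_rfl g).2 ⟨hr.1, admissible_zero_iff.2
      ⟨hs, hg, fun hc => hP.2 ((@Represents.hasChain_iff _ P.toPreorder _ hn _ _ hr _).2 hc)⟩⟩⟩,
      Quot.sound ⟨σ, fun a b => ?_⟩⟩
    refine (orderOfList_le_iff hg a b).trans ?_
    refine Iff.trans ?_ (@le_iff_eq_or_lt _ P _ _).symm
    exact or_congr σ.injective.eq_iff.symm (hr.2 a b).symm

theorem statement11 (n : ℕ) (hn : 1 ≤ n) : fLe 3 n = (3 ^ (n - 1) + 1) / 2 := by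
  rw [fLe_eq_card hn, card_admissibleLists_three hn]

end Paper
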